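/- (Highest and lowest weight projectors) The operators t₊₊ := ¼(2·id + 2i·d₂⁻¹ + u₁ + u₀ + i·(cup_w ∘ cap) + i·(cup ∘ cap_w)) and t₋₋ := ¼(2·id − 2i·d₂⁻¹ + u₁ + u₀ − i·(cup_w ∘ cap) − i·(cup ∘ cap_w)) in End(V⊗V) satisfy: t₊₊ is the projection onto ℂ·(v₊⊗v₊) with t₊₊(v₋⊗v₋) = t₊₊(v₊⊗v₋) = t₊₊(v₋⊗v₊) = 0; t₋₋ is the projection onto ℂ·(v₋⊗v₋) annihilating the other three basis vectors; t₊₊ and t₋₋ are orthogonal idempotents with t₊₊ + t₋₋ = t₂. Moreover, defining recursively t_{+^{m+1}} := (t_{+^m} ⊗ id_V) ∘ σ_m ∘ (t_{+^m} ⊗ id_V) with base case t_{+²} := t₊₊ (and similarly t_{−^{m+1}} from t₋₋), for every m ≥ 2 the operator t_{+^m} is the projection of V^{⊗m} onto ℂ·v₊^{⊗m} annihilating all other basis tensors v_ε, and t_{−^m} is the projection onto ℂ·v₋^{⊗m}. -/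

import Mathlib

open Matrix

noncomputable section

/-- Sign strings `ε ∈ {+,-}^m`; `true` encodes `+` and `false` encodes `-`. -/
abbrev Sgn (m : ℕ) := Fin m → Bool

/-- Endomorphisms of `V^{⊗m}` (`V = ℂ²`), as matrices indexed by sign strings. -/
abbrev Op (m : ℕ) := Matrix (Sgn m) (Sgn m) ℂ

/-- Linear maps `V^{⊗m} → V^{⊗n}`, as matrices (rows: target, columns: source). -/
abbrev Mor (m n : ℕ) := Matrix (Sgn n) (Sgn m) ℂ

/-- The basis vector `v_ε` of `V^{⊗m}`. -/
def bv {m : ℕ} (ε : Sgn m) : Sgn m → ℂ := fun δ => if δ = ε then 1 else 0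

/-- The coefficient of `cap` on `v_a ⊗ v_b`:
`cap (v₋ ⊗ v₊) = 1`, `cap (v₊ ⊗ v₋) = -1`, `cap (v₊ ⊗ v₊) = cap (v₋ ⊗ v₋) = 0`. -/
def capc (a b : Bool) : ℂ := if a then (if b then 0 else -1) else (if b then 1 else 0)

/-- The coefficient of `v_a ⊗ v_b` in `cup 1 = v₊ ⊗ v₋ - v₋ ⊗ v₊`. -/
def cupc (a b : Bool) : ℂ := if a then (if b then 0 else 1) else (if b then -1 else 0)

/-- The cap `V ⊗ V → ℂ`. -/
def capM : Mor 2 0 := Matrix.of fun _ ε => capc (ε 0) (ε 1)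

/-- The cup `ℂ → V ⊗ V`. -/
def cupM : Mor 0 2 := Matrix.of fun δ _ => cupc (δ 0) (δ 1)

/-- The tensor product of two linear maps. -/
def tensMor {a b c d : ℕ} (A : Mor a b) (B : Mor c d) : Mor (a + c) (b + d) :=
  Matrix.of fun δ ε =>
    A (fun i => δ (Fin.castAdd d i)) (fun i => ε (Fin.castAdd c i)) *
      B (fun j => δ (Fin.natAdd b j)) (fun j => ε (Fin.natAdd a j))

/-- The swap of the two tensor factors of `V ⊗ V`. -/
def swap2 : Op 2 := Matrix.of fun δ ε => if δ 0 = ε 1 ∧ δ 1 = ε 0 then 1 else 0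

/-- `id^{⊗p} ⊗ A ⊗ id^{⊗(m-p-2)}`: the operator `A` on two strands placed at the
(0-based) positions `p`, `p+1` among `m` strands. -/
def atPos (m p : ℕ) (A : Op 2) : Op m :=
  Matrix.of fun δ ε =>
    if h : p + 2 ≤ m then
      (if ∀ k : Fin m, k.val ≠ p → k.val ≠ p + 1 → δ k = ε k then 1 else 0) *
        A (fun i => δ ⟨p + i.val, Nat.lt_of_lt_of_le (Nat.add_lt_add_left i.isLt p) h⟩)
          (fun i => ε ⟨p + i.val, Nat.lt_of_lt_of_le (Nat.add_lt_add_left i.isLt p) h⟩)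
    else 0

/-- Cyclic rotation of sign strings: `(rotIdx δ) k = δ (k+1 mod m)`. -/
def rotIdx {m : ℕ} (δ : Sgn m) : Sgn m := fun k => δ ⟨(k.val + 1) % m, Nat.mod_lt _ k.pos⟩

/-- The rotation `d_m : V^{⊗m} → V^{⊗m}`, `d_m (v_ε ⊗ w) = i^{ε} (w ⊗ v_ε)`. -/
def dRot : (m : ℕ) → Op m
  | 0 => 1
  | (m + 1) =>
    Matrix.of fun δ' δ =>
      if δ' = rotIdx δ then (if δ 0 then Complex.I else -Complex.I) else 0

/-- The cap-cup generator `u_j` (`j` is 1-based, `1 ≤ j ≤ m-1`);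
`u_0 := d_m⁻¹ ∘ u_1 ∘ d_m` is the affine generator. -/
def uFull (m j : ℕ) : Op m :=
  if j = 0 then (dRot m)⁻¹ * atPos m 0 (cupM * capM) * dRot m
  else atPos m (j - 1) (cupM * capM)

/-- The extremal weight projectors `t_m`, defined by `t₁ = id`,
`t₂ = id + u₁/2 + u₀/2`, and `t_{m+1} = (t_m ⊗ id) ∘ σ_m ∘ (t_m ⊗ id)` for `m ≥ 2`
(with the convention `t₀ = 2·id`). -/
def tP : (m : ℕ) → Op m
  | 0 => (2 : ℂ) • 1
  | 1 => 1
  | 2 => 1 + (2⁻¹ : ℂ) • atPos 2 0 (cupM * capM) +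
      (2⁻¹ : ℂ) • ((dRot 2)⁻¹ * atPos 2 0 (cupM * capM) * dRot 2)
  | (m + 3) =>
    tensMor (tP (m + 2)) (1 : Op 1) * atPos (m + 3) (m + 1) swap2 *
      tensMor (tP (m + 2)) (1 : Op 1)

/-- `n` nested caps `Ca_n : V^{⊗2n} → ℂ`. -/
def CaM (n : ℕ) : Mor (n + n) 0 :=
  Matrix.of fun _ δ =>
    ∏ k : Fin n,
      capc (δ ⟨k.val, Nat.lt_of_lt_of_le k.isLt (Nat.le_add_right n n)⟩)
        (δ ⟨n + n - 1 - k.val,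
          Nat.lt_of_le_of_lt (Nat.sub_le _ _)
            (Nat.sub_lt (Nat.lt_of_lt_of_le k.pos (Nat.le_add_right n n)) Nat.one_pos)⟩)

/-- `n` nested cups `Cu_n : ℂ → V^{⊗2n}`. -/
def CuM (n : ℕ) : Mor 0 (n + n) :=
  Matrix.of fun δ _ =>
    ∏ k : Fin n,
      cupc (δ ⟨k.val, Nat.lt_of_lt_of_le k.isLt (Nat.le_add_right n n)⟩)
        (δ ⟨n + n - 1 - k.val,
          Nat.lt_of_le_of_lt (Nat.sub_le _ _)
            (Nat.sub_lt (Nat.lt_of_lt_of_le k.pos (Nat.le_add_right n n)) Nat.one_pos)⟩)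

/-- The canonical identification of sign strings induced by an equality of lengths. -/
def sgnCast {a b : ℕ} (h : a = b) : Sgn a ≃ Sgn b :=
  Equiv.arrowCongr (finCongr h) (Equiv.refl Bool)

/-- Reindexing of a linear map along equalities of the numbers of strands. -/
def rc {a b c d : ℕ} (h1 : a = b) (h2 : c = d) (A : Mor a c) : Mor b d :=
  Matrix.reindex (sgnCast h2) (sgnCast h1) A

/-- The idempotents `e_{m,n}`:
`e_{1,1} = -u₁/2 - d₂⁻¹ ∘ u₁ ∘ d₂ / 2` and
`e_{m,n} = -(t_m ⊗ t_n) ∘ u_m ∘ (t_m ⊗ t_n)` otherwise. -/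
def eP : (m n : ℕ) → Op (m + n)
  | 1, 1 =>
    (-(2⁻¹ : ℂ)) • atPos 2 0 (cupM * capM) +
      (-(2⁻¹ : ℂ)) • ((dRot 2)⁻¹ * atPos 2 0 (cupM * capM) * dRot 2)
  | m, n =>
    -(tensMor (tP m) (tP n) * atPos (m + n) (m - 1) (cupM * capM) * tensMor (tP m) (tP n))

/-- The wrap-around cup `cup_w = d₂ ∘ cup`. -/
def cupW : Mor 0 2 := dRot 2 * cupM

/-- The wrap-around cap `cap_w = cap ∘ d₂`. -/
def capW : Mor 2 0 := capM * dRot 2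

/-- `t₊₊ = ¼(2·id + 2i·d₂⁻¹ + u₁ + u₀ + i (cup_w ∘ cap) + i (cup ∘ cap_w))`. -/
def tpp2 : Op 2 :=
  (4⁻¹ : ℂ) • ((2 : ℂ) • (1 : Op 2) + ((2 : ℂ) * Complex.I) • (dRot 2)⁻¹ +
    atPos 2 0 (cupM * capM) + (dRot 2)⁻¹ * atPos 2 0 (cupM * capM) * dRot 2 +
    Complex.I • (cupW * capM) + Complex.I • (cupM * capW))

/-- `t₋₋ = ¼(2·id - 2i·d₂⁻¹ + u₁ + u₀ - i (cup_w ∘ cap) - i (cup ∘ cap_w))`. -/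
def tmm2 : Op 2 :=
  (4⁻¹ : ℂ) • ((2 : ℂ) • (1 : Op 2) - ((2 : ℂ) * Complex.I) • (dRot 2)⁻¹ +
    atPos 2 0 (cupM * capM) + (dRot 2)⁻¹ * atPos 2 0 (cupM * capM) * dRot 2 -
    Complex.I • (cupW * capM) - Complex.I • (cupM * capW))

/-- Highest weight projectors `t_{+^m}`, via the recursion of type (2.6) with
base case `t₊₊`. -/
def tpp : (m : ℕ) → Op m
  | 0 => 1
  | 1 => 1
  | 2 => tpp2
  | (m + 3) =>
    tensMor (tpp (m + 2)) (1 : Op 1) * atPos (m + 3) (m + 1) swap2 *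
      tensMor (tpp (m + 2)) (1 : Op 1)

/-- Lowest weight projectors `t_{-^m}`, via the recursion of type (2.6) with
base case `t₋₋`. -/
def tmm : (m : ℕ) → Op m
  | 0 => 1
  | 1 => 1
  | 2 => tmm2
  | (m + 3) =>
    tensMor (tmm (m + 2)) (1 : Op 1) * atPos (m + 3) (m + 1) swap2 *
      tensMor (tmm (m + 2)) (1 : Op 1)

/-- The projection of `V^{⊗m}` onto the line spanned by `v_b ⊗ ⋯ ⊗ v_b` along the other
basis tensors. -/
def constProj (b : Bool) (m : ℕ) : Op m :=
  Matrix.diagonal fun δ => if δ = (fun _ => b) then 1 else 0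

lemma constProj_mulVec_bv (b : Bool) (m : ℕ) (ε : Sgn m) :
    (constProj b m).mulVec (bv ε) = if ε = (fun _ => b) then bv ε else 0 := by
  ext δ
  rw [constProj, Matrix.mulVec_diagonal]
  by_cases hδ : δ = ε
  · subst hδ
    split_ifs <;> simp [bv]
  · split_ifs <;> simp [bv, hδ]

lemma constProj_mul_self (b : Bool) (m : ℕ) :
    constProj b m * constProj b m = constProj b m := by
  simp [constProj, Matrix.diagonal_mul_diagonal]

lemma constProj_mul_of_ne {b c : Bool} (h : b ≠ c) {m : ℕ} (hm : 0 < m) :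
    constProj b m * constProj c m = 0 := by
  rw [constProj, constProj, Matrix.diagonal_mul_diagonal, Matrix.diagonal_eq_zero]
  ext δ
  by_cases hb : δ = fun _ => b
  · have hc : δ ≠ fun _ => c := fun hc => h (congrFun (hb.symm.trans hc) ⟨0, hm⟩)
    simp [hc]
  · simp [hb]

lemma tensMor_constProj_one (b : Bool) (m : ℕ) :
    tensMor (constProj b m) (1 : Op 1) =
      Matrix.diagonal fun δ : Sgn (m + 1) => if ∀ i : Fin m, δ i.castSucc = b then 1 else 0 := by
  ext δ ε
  have key : δ = ε ↔ (∀ i : Fin m, δ i.castSucc = ε i.castSucc) ∧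
      δ (Fin.last m) = ε (Fin.last m) := by
    rw [funext_iff, Fin.forall_fin_succ']
  have hinit : (fun i => δ (Fin.castAdd 1 i)) = (fun i => ε (Fin.castAdd 1 i)) ↔
      ∀ i : Fin m, δ i.castSucc = ε i.castSucc := funext_iff
  have hlast : (fun j : Fin 1 => δ (Fin.natAdd m j)) = (fun j => ε (Fin.natAdd m j)) ↔
      δ (Fin.last m) = ε (Fin.last m) := by
    simp only [funext_iff, Fin.forall_fin_one]
    rfl
  have hconst : (fun i => δ (Fin.castAdd 1 i)) = (fun _ => b) ↔
      ∀ i : Fin m, δ i.castSucc = b := funext_iff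
  simp only [tensMor, constProj, Matrix.of_apply, Matrix.diagonal_apply, Matrix.one_apply,
    hinit, hlast, hconst, key, ite_and]
  split_ifs <;> simp

/-- The recursion `A ↦ (A ⊗ id) ∘ σ ∘ (A ⊗ id)` sends `constProj b` to `constProj b`. -/
lemma constProj_recursion (b : Bool) (m : ℕ) :
    tensMor (constProj b (m + 2)) (1 : Op 1) * atPos (m + 3) (m + 1) swap2 *
      tensMor (constProj b (m + 2)) (1 : Op 1) = constProj b (m + 3) := by
  rw [tensMor_constProj_one]
  ext δ ε
  rw [Matrix.mul_diagonal, Matrix.diagonal_mul, constProj, Matrix.diagonal_apply]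
  have all_iff : ∀ η : Sgn (m + 3), η = (fun _ => b) ↔
      (∀ i : Fin (m + 2), η i.castSucc = b) ∧ η (Fin.last (m + 2)) = b := fun η => by
    rw [funext_iff, Fin.forall_fin_succ']
  have hp : (⟨m + 1, by omega⟩ : Fin (m + 3)) = (Fin.last (m + 1)).castSucc := rfl
  have hq : (⟨m + 1 + 1, by omega⟩ : Fin (m + 3)) = Fin.last (m + 2) := rfl
  by_cases hδ : ∀ i : Fin (m + 2), δ i.castSucc = b
  swap
  · have : δ ≠ fun _ => b := fun h => hδ ((all_iff δ).1 h).1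
    simp [hδ, this]
  by_cases hε : ∀ i : Fin (m + 2), ε i.castSucc = b
  swap
  · have : δ = ε → δ ≠ fun _ => b := fun e h => hε ((all_iff ε).1 (e ▸ h)).1
    by_cases e : δ = ε <;> simp_all
  have hoff : ∀ k : Fin (m + 3), k.val ≠ m + 1 → k.val ≠ m + 1 + 1 → δ k = ε k := by
    intro k _ h2
    have hk : k = (⟨k.val, by omega⟩ : Fin (m + 2)).castSucc := rfl
    rw [hk, hδ, hε]
  have hent : atPos (m + 3) (m + 1) swap2 δ ε =
      if b = ε (Fin.last (m + 2)) ∧ δ (Fin.last (m + 2)) = b then 1 else 0 := by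
    simp only [atPos, swap2, Matrix.of_apply, if_pos hoff, one_mul]
    rw [dif_pos (by omega)]
    simp only [Fin.val_zero, Fin.val_one, add_zero, hp, hq, hδ, hε]
  rw [hent, if_pos hδ, if_pos hε, one_mul, mul_one]
  by_cases h1 : δ (Fin.last (m + 2)) = b
  · have dc : δ = fun _ => b := (all_iff δ).2 ⟨hδ, h1⟩
    by_cases h2 : ε (Fin.last (m + 2)) = b
    · have ec : ε = fun _ => b := (all_iff ε).2 ⟨hε, h2⟩
      simp [dc, ec]
    · have : δ ≠ ε := fun e => h2 (e ▸ h1)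
      simp [this, Ne.symm h2]
  · have : δ ≠ fun _ => b := fun h => h1 ((all_iff δ).1 h).2
    simp [h1, this]

lemma sum_sgn_two (f : Sgn 2 → ℂ) :
    ∑ δ, f δ = f ![true, true] + f ![true, false] + (f ![false, true] + f ![false, false]) := by
  rw [← (finTwoArrowEquiv Bool).symm.sum_comp, Fintype.sum_prod_type]
  simp [finTwoArrowEquiv]

lemma op_two_ext {A B : Op 2} (h : ∀ a b c d, A ![a, b] ![c, d] = B ![a, b] ![c, d]) :
    A = B := by
  ext δ ε
  have e : ∀ η : Sgn 2, η = ![η 0, η 1] := fun η => by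
    ext i; fin_cases i <;> rfl
  rw [e δ, e ε]
  exact h _ _ _ _

lemma vecTwo_inj (a b c d : Bool) : (![a, b] : Sgn 2) = ![c, d] ↔ a = c ∧ b = d := by
  simp [funext_iff, Fin.forall_fin_two]

lemma dRot_two_apply (a b c d : Bool) :
    dRot 2 ![a, b] ![c, d] =
      if a = d ∧ b = c then (if c then Complex.I else -Complex.I) else 0 := by
  have h : rotIdx ![c, d] = ![d, c] := by
    ext i; fin_cases i <;> rfl
  cases a <;> cases b <;> cases c <;> cases d <;> simp [dRot, h]

/-- The matrix of `d₂⁻¹`. -/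
lemma dRot_two_inv :
    (dRot 2)⁻¹ = Matrix.of fun δ ε : Sgn 2 =>
      if δ 0 = ε 1 ∧ δ 1 = ε 0 then (if ε 1 then -Complex.I else Complex.I) else 0 := by
  refine Matrix.inv_eq_right_inv (op_two_ext fun a b c d => ?_)
  rw [Matrix.mul_apply, sum_sgn_two]
  simp only [dRot_two_apply, Matrix.of_apply, Matrix.one_apply, vecTwo_inj]
  cases a <;> cases b <;> cases c <;> cases d <;> simp

lemma atPos_two_zero (A : Op 2) : atPos 2 0 A = A := by
  refine op_two_ext fun a b c d => ?_
  simp only [atPos, Matrix.of_apply]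
  rw [dif_pos le_rfl, if_pos, one_mul]
  · congr 1 <;> ext i <;> fin_cases i <;> rfl
  · intro k h0 h1
    omega

lemma cupM_mul_capM_apply (a b c d : Bool) :
    (cupM * capM) ![a, b] ![c, d] = cupc a b * capc c d := by
  simp [Matrix.mul_apply, cupM, capM]

lemma cupW_mul_capM_apply (a b c d : Bool) :
    (cupW * capM) ![a, b] ![c, d] =
      (if b then Complex.I else -Complex.I) * cupc b a * capc c d := by
  rw [cupW, Matrix.mul_assoc, Matrix.mul_apply, sum_sgn_two]
  simp only [dRot_two_apply, cupM_mul_capM_apply]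
  cases a <;> cases b <;> simp [mul_assoc]

lemma cupM_mul_capW_apply (a b c d : Bool) :
    (cupM * capW) ![a, b] ![c, d] =
      cupc a b * capc d c * (if c then Complex.I else -Complex.I) := by
  rw [capW, ← Matrix.mul_assoc, Matrix.mul_apply, sum_sgn_two]
  simp only [dRot_two_apply, cupM_mul_capM_apply]
  cases c <;> cases d <;> simp

lemma dRot_two_inv_mul_apply (A : Op 2) (a b : Bool) (ε : Sgn 2) :
    ((dRot 2)⁻¹ * A) ![a, b] ε = (if a then -Complex.I else Complex.I) * A ![b, a] ε := by
  rw [Matrix.mul_apply, sum_sgn_two, dRot_two_inv]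
  cases a <;> cases b <;> simp

/-- The matrix of the affine generator `u₀` on two strands. -/
lemma dRot_two_conj_apply (a b c d : Bool) :
    ((dRot 2)⁻¹ * (cupM * capM) * dRot 2) ![a, b] ![c, d] =
      if a = b ∨ c = d then 0 else -1 := by
  rw [Matrix.mul_apply, sum_sgn_two]
  simp only [dRot_two_inv_mul_apply, dRot_two_apply, cupM_mul_capM_apply]
  cases a <;> cases b <;> cases c <;> cases d <;> simp [cupc, capc]

lemma tpp2_eq_constProj : tpp2 = constProj true 2 := by
  have hc : (fun _ => true : Sgn 2) = ![true, true] := by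
    ext i; fin_cases i <;> rfl
  refine op_two_ext fun a b c d => ?_
  simp only [tpp2, atPos_two_zero, constProj, hc, Matrix.smul_apply, Matrix.add_apply,
    dRot_two_conj_apply, cupM_mul_capM_apply, cupW_mul_capM_apply, cupM_mul_capW_apply,
    Matrix.one_apply, Matrix.diagonal_apply, vecTwo_inj, smul_eq_mul]
  simp only [dRot_two_inv, Matrix.of_apply]
  cases a <;> cases b <;> cases c <;> cases d <;> simp [cupc, capc] <;>
    ring_nf <;> norm_num

lemma tmm2_eq_constProj : tmm2 = constProj false 2 := by
  have hc : (fun _ => false : Sgn 2) = ![false, false] := by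
    ext i; fin_cases i <;> rfl
  refine op_two_ext fun a b c d => ?_
  simp only [tmm2, atPos_two_zero, constProj, hc, Matrix.smul_apply, Matrix.add_apply,
    Matrix.sub_apply, dRot_two_conj_apply, cupM_mul_capM_apply, cupW_mul_capM_apply,
    cupM_mul_capW_apply, Matrix.one_apply, Matrix.diagonal_apply, vecTwo_inj, smul_eq_mul]
  simp only [dRot_two_inv, Matrix.of_apply]
  cases a <;> cases b <;> cases c <;> cases d <;> simp [cupc, capc] <;>
    ring_nf <;> norm_num

lemma tpp_eq_constProj (m : ℕ) : tpp (m + 2) = constProj true (m + 2) := by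
  induction m with
  | zero => rw [← tpp2_eq_constProj, tpp]
  | succ m ih => rw [← constProj_recursion, ← ih, tpp]

lemma tmm_eq_constProj (m : ℕ) : tmm (m + 2) = constProj false (m + 2) := by
  induction m with
  | zero => rw [← tmm2_eq_constProj, tmm]
  | succ m ih => rw [← constProj_recursion, ← ih, tmm]

lemma tpp2_add_tmm2 : tpp2 + tmm2 = tP 2 := by
  rw [tpp2, tmm2, tP]
  module

/-- Highest and lowest weight projectors. -/
theorem highest_lowest_weight_projectors :
    (∀ ε : Sgn 2, tpp2.mulVec (bv ε) = if ε = (fun _ => true) then bv ε else 0) ∧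
    (∀ ε : Sgn 2, tmm2.mulVec (bv ε) = if ε = (fun _ => false) then bv ε else 0) ∧
    tpp2 * tpp2 = tpp2 ∧ tmm2 * tmm2 = tmm2 ∧
    tpp2 * tmm2 = 0 ∧ tmm2 * tpp2 = 0 ∧
    tpp2 + tmm2 = tP 2 ∧
    (∀ m : ℕ, 2 ≤ m → ∀ ε : Sgn m,
      (tpp m).mulVec (bv ε) = if ε = (fun _ => true) then bv ε else 0) ∧
    (∀ m : ℕ, 2 ≤ m → ∀ ε : Sgn m,
      (tmm m).mulVec (bv ε) = if ε = (fun _ => false) then bv ε else 0) := by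
  refine ⟨?_, ?_, ?_, ?_, ?_, ?_, tpp2_add_tmm2, ?_, ?_⟩
  · exact tpp2_eq_constProj ▸ constProj_mulVec_bv true 2
  · exact tmm2_eq_constProj ▸ constProj_mulVec_bv false 2
  · rw [tpp2_eq_constProj, constProj_mul_self]
  · rw [tmm2_eq_constProj, constProj_mul_self]
  · rw [tpp2_eq_constProj, tmm2_eq_constProj, constProj_mul_of_ne (by decide) two_pos]
  · rw [tpp2_eq_constProj, tmm2_eq_constProj, constProj_mul_of_ne (by decide) two_pos]
  · intro m hm
    obtain ⟨k, rfl⟩ := Nat.exists_eq_add_of_le' hm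
    exact tpp_eq_constProj k ▸ constProj_mulVec_bv true (k + 2)
  · intro m hm
    obtain ⟨k, rfl⟩ := Nat.exists_eq_add_of_le' hm
    exact tmm_eq_constProj k ▸ constProj_mulVec_bv false (k + 2)
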